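/- For every positive integer c, there exists a word-representable graph with representation number exactly 3 that is not c-colorable; that is, the class R_3 of graphs with representation number 3 is not contained in the class of c-colorable graphs for any constant c. -/

import Mathlib

/-- Two letters `x` and `y` alternate in the word `w` if, after deleting all letters
other than `x` and `y`, no two equal letters are consecutive. -/
def Alternate {V : Type*} [DecidableEq V] (w : List V) (x y : V) : Prop :=
  (w.filter (fun z => decide (z = x ∨ z = y))).Chain' (· ≠ ·)

/-- A word `w` represents the graph `G` if every vertex occurs in `w` and two distinct
vertices alternate in `w` exactly when they are adjacent in `G`. -/
def Represents {V : Type*} [DecidableEq V] (w : List V) (G : SimpleGraph V) : Prop :=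
  (∀ v : V, v ∈ w) ∧ ∀ x y : V, x ≠ y → (Alternate w x y ↔ G.Adj x y)

/-- A graph is word-representable if some word represents it. -/
def WordRepresentable {V : Type*} [DecidableEq V] (G : SimpleGraph V) : Prop :=
  ∃ w : List V, Represents w G

/-- A word is `k`-uniform if every letter occurs in it exactly `k` times. -/
def KUniform {V : Type*} [DecidableEq V] (k : ℕ) (w : List V) : Prop :=
  ∀ v : V, w.count v = k

/-- A graph is `k`-word-representable if some `k`-uniform word represents it. -/
def KRepresentable {V : Type*} [DecidableEq V] (G : SimpleGraph V) (k : ℕ) : Prop :=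
  ∃ w : List V, KUniform k w ∧ Represents w G

/-- The representation number of a graph: the least `k` such that it is
`k`-word-representable. -/
noncomputable def reprNum {V : Type*} [DecidableEq V] (G : SimpleGraph V) : ℕ :=
  sInf {k | KRepresentable G k}

open SimpleGraph

section Words

variable {V W X : Type*} [DecidableEq V] [DecidableEq W] [DecidableEq X]

lemma alternate_iff_of_filter_eq {w L : List V} {x y : V}
    (h : w.filter (fun z => decide (z = x ∨ z = y)) = L) :
    Alternate w x y ↔ L.IsChain (· ≠ ·) := by
  subst h
  rfl

lemma alternate_map {f : V → W} (hf : Function.Injective f) (w : List V) (x y : V) :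
    Alternate (w.map f) (f x) (f y) ↔ Alternate w x y := by
  rw [alternate_iff_of_filter_eq rfl, alternate_iff_of_filter_eq rfl]
  simp [List.filter_map, Function.comp_def, List.isChain_map, hf.eq_iff]

lemma alternate_append_left {u v : List V} {x y : V} (hx : x ∉ v) (hy : y ∉ v) :
    Alternate (u ++ v) x y ↔ Alternate u x y := by
  have h : v.filter (fun z => decide (z = x ∨ z = y)) = [] :=
    List.filter_eq_nil_iff.2 fun z hz => by
      simpa using ⟨ne_of_mem_of_not_mem hz hx, ne_of_mem_of_not_mem hz hy⟩
  simp only [Alternate, List.filter_append, h, List.append_nil]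

lemma alternate_append_right {u v : List V} {x y : V} (hx : x ∉ u) (hy : y ∉ u) :
    Alternate (u ++ v) x y ↔ Alternate v x y := by
  have h : u.filter (fun z => decide (z = x ∨ z = y)) = [] :=
    List.filter_eq_nil_iff.2 fun z hz => by
      simpa using ⟨ne_of_mem_of_not_mem hz hx, ne_of_mem_of_not_mem hz hy⟩
  simp only [Alternate, List.filter_append, h, List.nil_append]

lemma Alternate.comm {w : List V} {x y : V} : Alternate w x y ↔ Alternate w y x := by
  simp only [Alternate, or_comm]

lemma not_alternate_append {u v : List V} {x y : V} (hu : ∀ z ∈ u, z ≠ y)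
    (hx : 2 ≤ u.count x) : ¬ Alternate (u ++ v) x y := by
  have h : u.filter (fun z => decide (z = x ∨ z = y)) = List.replicate (u.count x) x := by
    rw [← List.filter_eq]
    exact List.filter_congr fun z hz => by simp [hu z hz]
  obtain ⟨n, hn⟩ := Nat.exists_eq_add_of_le' hx
  rw [alternate_iff_of_filter_eq (List.filter_append ..), h, hn]
  simp [List.replicate_succ]

lemma KRepresentable.of_disjoint_embeddings {G : SimpleGraph V} {H : SimpleGraph W}
    {K : SimpleGraph X} {k : ℕ} (hk : 2 ≤ k) (hG : KRepresentable G k) (hH : KRepresentable H k)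
    (f : G ↪g K) (g : H ↪g K) (hcover : ∀ x, (∃ v, f v = x) ∨ ∃ w, g w = x)
    (hne : ∀ v w, f v ≠ g w) (hnadj : ∀ v w, ¬ K.Adj (f v) (g w)) : KRepresentable K k := by
  obtain ⟨u, hu, humem, huadj⟩ := hG
  obtain ⟨v, hv, hvmem, hvadj⟩ := hH
  have hf (a : W) : g a ∉ u.map f := by simp [hne]
  have hg (a : V) : f a ∉ v.map g := by simp [(hne _ _).symm]
  have hfg (a : V) (b : W) : ¬ Alternate (u.map f ++ v.map g) (f a) (g b) :=
    not_alternate_append (fun z hz => ne_of_mem_of_not_mem hz (hf b))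
      (by rwa [List.count_map_of_injective _ _ f.injective, hu])
  refine ⟨u.map f ++ v.map g, fun x => ?_, fun x => ?_, fun x y hxy => ?_⟩
  · obtain ⟨a, rfl⟩ | ⟨a, rfl⟩ := hcover x
    · rw [List.count_append, List.count_map_of_injective _ _ f.injective, hu,
        List.count_eq_zero.2 (hg a), add_zero]
    · rw [List.count_append, List.count_map_of_injective _ _ g.injective, hv,
        List.count_eq_zero.2 (hf a), zero_add]
  · obtain ⟨a, rfl⟩ | ⟨a, rfl⟩ := hcover x
    · exact List.mem_append_left _ (List.mem_map_of_mem (humem a))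
    · exact List.mem_append_right _ (List.mem_map_of_mem (hvmem a))
  · obtain ⟨a, rfl⟩ | ⟨a, rfl⟩ := hcover x <;> obtain ⟨b, rfl⟩ | ⟨b, rfl⟩ := hcover y
    · rw [alternate_append_left (hg a) (hg b), alternate_map f.injective,
        huadj a b (ne_of_apply_ne f hxy), f.map_adj_iff]
    · exact iff_of_false (hfg a b) (hnadj a b)
    · rw [Alternate.comm, K.adj_comm]
      exact iff_of_false (hfg b a) (hnadj b a)
    · rw [alternate_append_right (hf a) (hf b), alternate_map g.injective,
        hvadj a b (ne_of_apply_ne g hxy), g.map_adj_iff]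

lemma filter_eq_pair_of_count_eq_one {w : List V} {x y : V} (hxy : x ≠ y)
    (hx : w.count x = 1) (hy : w.count y = 1) :
    w.filter (fun z => decide (z = x ∨ z = y)) = [x, y] ∨
      w.filter (fun z => decide (z = x ∨ z = y)) = [y, x] := by
  have h : (w.filter (fun z => decide (z = x ∨ z = y))).Perm [x, y] := by
    rw [List.perm_iff_count]
    intro z
    by_cases hzx : z = x
    · subst hzx
      simp [List.count_filter, hx, hxy.symm]
    by_cases hzy : z = y
    · subst hzy
      simp [List.count_filter, hy, hxy]
    rw [List.count_eq_zero.2 (by simp [hzx, hzy]), List.count_eq_zero.2 (by simp [hzx, hzy])]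
  exact List.perm_pair.1 h

lemma alternate_of_count_eq_one {w : List V} {x y : V} (hxy : x ≠ y)
    (hx : w.count x = 1) (hy : w.count y = 1) : Alternate w x y := by
  rcases filter_eq_pair_of_count_eq_one hxy hx hy with h | h <;>
    simp [alternate_iff_of_filter_eq h, hxy, hxy.symm]

lemma kRepresentable_three_top [Fintype V] : KRepresentable (⊤ : SimpleGraph V) 3 := by
  set l := (Finset.univ : Finset V).toList with hl
  have hc (v : V) : l.count v = 1 :=
    List.count_eq_one_of_mem (Finset.nodup_toList _) (by simp [hl])
  refine ⟨l ++ l ++ l, fun v => by simp [hc], fun v => by simp [hl], fun x y hxy => ?_⟩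
  simp only [top_adj, hxy, ne_eq, not_false_eq_true, iff_true]
  rw [alternate_iff_of_filter_eq rfl]
  rcases filter_eq_pair_of_count_eq_one hxy (hc x) (hc y) with h | h <;>
    simp only [List.filter_append, h] <;> simp [hxy, hxy.symm]

/-- The letter `x` occurs in `w` exactly at the two positions `a < b`. -/
def OccursAt (w : List V) (x : V) (a b : ℕ) : Prop :=
  a < b ∧ ∀ i, w[i]? = some x ↔ i = a ∨ i = b

lemma exists_occursAt {w : List V} {x : V} (h : w.count x = 2) : ∃ a b, OccursAt w x a b := by
  have h' : w.filter (· == x) = [x, x] := by simp [List.filter_beq, h]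
  obtain ⟨l₁, m, rfl, h₁, -, hm⟩ := List.filter_eq_cons_iff.1 h'
  obtain ⟨l₂, l₃, rfl, h₂, -, h₃⟩ := List.filter_eq_cons_iff.1 hm
  have hget {l : List V} (hl : ∀ z ∈ l, ¬ (z == x) = true) (j : ℕ) : l[j]? ≠ some x := fun hj =>
    hl x (List.mem_of_getElem? hj) (by simp)
  refine ⟨l₁.length, l₁.length + 1 + l₂.length, by omega, fun i => ?_⟩
  have h₁' := hget h₁ i
  have h₂' := hget h₂ (i - l₁.length - 1)
  have h₃' := hget (List.filter_eq_nil_iff.1 h₃) (i - l₁.length - 1 - l₂.length - 1)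
  rw [List.getElem?_append, List.getElem?_cons, List.getElem?_append, List.getElem?_cons]
  split_ifs <;> simp_all <;> omega

/-- The intervals `[a, b]` and `[c, d]` overlap, neither containing the other. -/
def Crossing (a b c d : ℕ) : Prop :=
  a < c ∧ c < b ∧ b < d ∨ c < a ∧ a < d ∧ d < b

lemma alternate_iff_crossing {w : List V} {x y : V} {a b c d : ℕ} (hxy : x ≠ y)
    (hx : w.count x = 2) (hy : w.count y = 2) (hab : OccursAt w x a b)
    (hcd : OccursAt w y c d) : Alternate w x y ↔ Crossing a b c d := by
  set L := w.filter (fun z => decide (z = x ∨ z = y)) with hL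
  have hp : L.Perm [x, x, y, y] := by
    rw [List.perm_iff_count]
    intro z
    by_cases hzx : z = x
    · subst hzx
      simp [hL, List.count_filter, hx, hxy.symm]
    by_cases hzy : z = y
    · subst hzy
      simp [hL, List.count_filter, hy, hxy]
    rw [List.count_eq_zero.2 (by simp [hL, hzx, hzy]), List.count_eq_zero.2 (by simp [hzx, hzy])]
  obtain ⟨f, hf⟩ := List.sublist_iff_exists_orderEmbedding_getElem?_eq.1
    (List.filter_sublist : L.Sublist w)
  obtain ⟨s, t, u, v, hs⟩ : ∃ s t u v, L = [s, t, u, v] := List.length_eq_four.1 hp.length_eq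
  have hlt₀ : f 0 < f 1 := f.strictMono (by simp)
  have hlt₁ : f 1 < f 2 := f.strictMono (by simp)
  have hlt₂ : f 2 < f 3 := f.strictMono (by simp)
  have hcx := hp.count_eq x
  have hcy := hp.count_eq y
  have hmem : ∀ z ∈ L, z = x ∨ z = y := fun z hz => by simpa using hp.subset hz
  have halt : Alternate w x y ↔ s ≠ t ∧ t ≠ u ∧ u ≠ v := by
    rw [alternate_iff_of_filter_eq hL.symm, hs]
    simp
  rw [halt]
  rw [← hL, hs] at hf
  rw [hs] at hcx hcy hmem
  have hfx (i : ℕ) : w[f i]? = some x → f i = a ∨ f i = b := (hab.2 (f i)).1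
  have hfy (i : ℕ) : w[f i]? = some y → f i = c ∨ f i = d := (hcd.2 (f i)).1
  simp only [← hf] at hfx hfy
  have hx₀ := hfx 0
  have hx₁ := hfx 1
  have hx₂ := hfx 2
  have hx₃ := hfx 3
  have hy₀ := hfy 0
  have hy₁ := hfy 1
  have hy₂ := hfy 2
  have hy₃ := hfy 3
  simp only [List.getElem?_cons_zero, List.getElem?_cons_succ, Option.some.injEq]
    at hx₀ hx₁ hx₂ hx₃ hy₀ hy₁ hy₂ hy₃
  have habl := hab.1
  have hcdl := hcd.1
  clear hfx hfy hf hL halt hab hcd hp hs hx hy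
  generalize f 0 = n₀ at *
  generalize f 1 = n₁ at *
  generalize f 2 = n₂ at *
  generalize f 3 = n₃ at *
  clear f L w
  simp only [List.count_cons, List.count_nil, List.mem_cons, List.not_mem_nil, or_false,
    forall_eq_or_imp, forall_eq, beq_iff_eq] at hmem hcx hcy
  unfold Crossing
  obtain ⟨h₀ | h₀, h₁ | h₁, h₂ | h₂, h₃ | h₃⟩ := hmem <;>
    simp only [h₀, h₁, h₂, h₃, hxy, hxy.symm, if_true, if_false, forall_const, ne_eq,
      not_true_eq_false, not_false_eq_true, false_imp_iff, eq_self, and_true, and_false,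
      true_iff, false_iff]
      at hx₀ hx₁ hx₂ hx₃ hy₀ hy₁ hy₂ hy₃ hcx hcy ⊢ <;> omega

end Words

/-- The triangular prism. -/
abbrev prism : SimpleGraph (Fin 3 × Fin 2) := (⊤ : SimpleGraph (Fin 3)) □ (⊤ : SimpleGraph (Fin 2))

lemma kRepresentable_three_prism : KRepresentable prism 3 := by
  refine ⟨[(2, 0), (1, 1), (0, 0), (2, 1), (1, 0), (2, 0), (0, 1), (0, 0), (1, 1),
    (1, 0), (2, 1), (0, 1), (1, 1), (2, 0), (2, 1), (0, 0), (0, 1), (1, 0)], ?_, ?_, ?_⟩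
  · unfold KUniform; decide
  · decide
  · simp only [alternate_iff_of_filter_eq rfl, boxProd_adj, top_adj]; decide

lemma Crossing.of_lt {a b c d : ℕ} (h : Crossing a b c d) (hac : a < c) : c < b ∧ b < d := by
  unfold Crossing at h
  omega

lemma no_prism_of_lt {a b c a' b' c' p q r p' q' r' : ℕ}
    (hp : p < p') (hq : q < q') (hr : r < r')
    (hpa : Crossing p p' a a') (hpb : ¬ Crossing p p' b b') (hpc : ¬ Crossing p p' c c')
    (hqa : ¬ Crossing q q' a a') (hqb : Crossing q q' b b') (hqc : ¬ Crossing q q' c c')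
    (hra : ¬ Crossing r r' a a') (hrb : ¬ Crossing r r' b b') (hrc : Crossing r r' c c')
    (hab : Crossing a a' b b') (hbc : Crossing b b' c c') (hac : Crossing a a' c c')
    (hpq : Crossing p p' q q') (hqr : Crossing q q' r r') (hpr : Crossing p p' r r')
    (hlt : a < b) (hlt' : b < c)
    (npb : p ≠ b ∧ p ≠ b' ∧ p' ≠ b ∧ p' ≠ b') (npc : p ≠ c ∧ p ≠ c' ∧ p' ≠ c ∧ p' ≠ c')
    (nqa : q ≠ a ∧ q ≠ a' ∧ q' ≠ a ∧ q' ≠ a') (nqc : q ≠ c ∧ q ≠ c' ∧ q' ≠ c ∧ q' ≠ c')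
    (nra : r ≠ a ∧ r ≠ a' ∧ r' ≠ a ∧ r' ≠ a') (nrb : r ≠ b ∧ r ≠ b' ∧ r' ≠ b ∧ r' ≠ b') :
    False := by
  obtain ⟨-, hab⟩ := hab.of_lt hlt
  obtain ⟨-, hbc⟩ := hbc.of_lt hlt'
  obtain ⟨hac, -⟩ := hac.of_lt (hlt.trans hlt')
  unfold Crossing at *
  have hP : p < a ∧ a < p' ∧ p' < b ∨ a < p ∧ p < b ∧ c' < p' ∨
      c < p ∧ p < a' ∧ a' < p' ∧ p' < b' := by
    clear hqa hqb hqc hra hrb hrc hpq hqr hpr nqa nqc nra nrb hq hr; omega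
  have hQ : a < q ∧ q < b ∧ b < q' ∧ q' < c ∨ a' < q ∧ q < b' ∧ b' < q' ∧ q' < c' := by
    clear hpa hpb hpc hra hrb hrc hpq hqr hpr hP npb npc nra nrb hp hr; omega
  have hR : b < r ∧ r < c ∧ c < r' ∧ r' < a' ∨ b' < r ∧ r < c' ∧ c' < r' ∨
      r < a ∧ b' < r' ∧ r' < c' := by
    clear hpa hpb hpc hqa hqb hqc hpq hqr hpr hP hQ npb npc nqa nqc hp hq; omega
  clear hpa hpb hpc hqa hqb hqc hra hrb hrc npb npc nqa nqc nra nrb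
  omega
lemma not_kRepresentable_two_of_prism {V : Type*} [DecidableEq V] {G : SimpleGraph V}
    (f : prism ↪g G) : ¬ KRepresentable G 2 := by
  rintro ⟨w, hw, -, hadj⟩
  choose s t hst using fun v => exists_occursAt (hw (f v))
  have hlt (v) : s v < t v := (hst v).1
  have hcross {u v} (huv : u ≠ v) : Crossing (s u) (t u) (s v) (t v) ↔ prism.Adj u v := by
    rw [← f.map_adj_iff, ← hadj _ _ (f.injective.ne huv),
      alternate_iff_crossing (f.injective.ne huv) (hw _) (hw _) (hst u) (hst v)]
  have hne {u v} (huv : u ≠ v) : s u ≠ s v ∧ s u ≠ t v ∧ t u ≠ s v ∧ t u ≠ t v := by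
    have h {i j : ℕ} (hi : w[i]? = some (f u)) (hj : w[j]? = some (f v)) : i ≠ j := by
      rintro rfl
      exact f.injective.ne huv (Option.some.inj (hi.symm.trans hj))
    have hsu := ((hst u).2 (s u)).2 (.inl rfl)
    have htu := ((hst u).2 (t u)).2 (.inr rfl)
    have hsv := ((hst v).2 (s v)).2 (.inl rfl)
    have htv := ((hst v).2 (t v)).2 (.inr rfl)
    exact ⟨h hsu hsv, h hsu htv, h htu hsv, h htu htv⟩
  obtain ⟨i, j, k, hij, hjk, hik, h₁, h₂⟩ : ∃ i j k : Fin 3, i ≠ j ∧ j ≠ k ∧ i ≠ k ∧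
      s (i, 0) < s (j, 0) ∧ s (j, 0) < s (k, 0) := by
    have h₀₁ := (hne (u := (0, 0)) (v := (1, 0)) (by decide)).1
    have h₁₂ := (hne (u := (1, 0)) (v := (2, 0)) (by decide)).1
    have h₀₂ := (hne (u := (0, 0)) (v := (2, 0)) (by decide)).1
    rcases h₀₁.lt_or_gt with h | h <;> rcases h₁₂.lt_or_gt with h' | h' <;>
      rcases h₀₂.lt_or_gt with h'' | h''
    · exact ⟨0, 1, 2, by decide, by decide, by decide, h, h'⟩
    · omega
    · exact ⟨0, 2, 1, by decide, by decide, by decide, h'', h'⟩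
    · exact ⟨2, 0, 1, by decide, by decide, by decide, h'', h⟩
    · exact ⟨1, 0, 2, by decide, by decide, by decide, h, h''⟩
    · exact ⟨1, 2, 0, by decide, by decide, by decide, h', h''⟩
    · omega
    · exact ⟨2, 1, 0, by decide, by decide, by decide, h', h⟩
  have hadj' {u v} (h : prism.Adj u v) : Crossing (s u) (t u) (s v) (t v) := (hcross h.ne).2 h
  have hnadj {u v} (huv : u ≠ v) (h : ¬ prism.Adj u v) :
      ¬ Crossing (s u) (t u) (s v) (t v) := mt (hcross huv).1 h
  have hback {i j : Fin 3} (h : i ≠ j) : ¬ Crossing (s (i, 1)) (t (i, 1)) (s (j, 0)) (t (j, 0)) :=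
    hnadj (by simp) (by simp [boxProd_adj, h])
  have hrung (i : Fin 3) : Crossing (s (i, 1)) (t (i, 1)) (s (i, 0)) (t (i, 0)) :=
    hadj' (by simp [boxProd_adj])
  have hside {i j : Fin 3} (e : Fin 2) (h : i ≠ j) :
      Crossing (s (i, e)) (t (i, e)) (s (j, e)) (t (j, e)) :=
    hadj' (by simp [boxProd_adj, h])
  have hne' (i j : Fin 3) := hne (u := (i, 1)) (v := (j, 0)) (by simp)
  exact no_prism_of_lt (hlt (i, 1)) (hlt (j, 1)) (hlt (k, 1))
    (hrung i) (hback hij) (hback hik) (hback hij.symm) (hrung j) (hback hjk)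
    (hback hik.symm) (hback hjk.symm) (hrung k) (hside 0 hij) (hside 0 hjk) (hside 0 hik)
    (hside 1 hij) (hside 1 hjk) (hside 1 hik) h₁ h₂
    (hne' i j) (hne' i k) (hne' j i) (hne' j k) (hne' k i) (hne' k j)

lemma three_le_of_kRepresentable {V : Type*} [DecidableEq V] {G : SimpleGraph V} {k : ℕ}
    (f : prism ↪g G) (h : KRepresentable G k) : 3 ≤ k := by
  by_contra! hk
  interval_cases k
  · obtain ⟨w, hw, hmem, -⟩ := h
    exact List.count_eq_zero.1 (hw (f (0, 0))) (hmem _)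
  · obtain ⟨w, hw, -, hadj⟩ := h
    have hne : f (0, 0) ≠ f (1, 1) := f.injective.ne (by decide)
    have := (hadj _ _ hne).1 (alternate_of_count_eq_one hne (hw _) (hw _))
    rw [f.map_adj_iff] at this
    revert this
    simp [boxProd_adj]
  · exact not_kRepresentable_two_of_prism f h

/-- For every positive integer `c`, there exists a word-representable graph with
representation number exactly 3 that is not `c`-colorable: the class `R₃` is not
contained in the class of `c`-colorable graphs for any constant `c`. -/
theorem R3_not_c_colorable (c : ℕ) (hc : 0 < c) :
    ∃ (n : ℕ) (G : SimpleGraph (Fin n)),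
      WordRepresentable G ∧ reprNum G = 3 ∧ ¬ G.Colorable c := by
  let S := prism ⊕g (⊤ : SimpleGraph (Fin (c + 1)))
  let e := S.overFinIso rfl
  let f := Embedding.sumInl.trans e.toEmbedding
  let g := Embedding.sumInr.trans e.toEmbedding
  have h3 : KRepresentable (S.overFin rfl) 3 := by
    refine .of_disjoint_embeddings (by norm_num) kRepresentable_three_prism
      kRepresentable_three_top f g (fun x => ?_) (fun v w h => ?_) (fun v w h => ?_)
    · obtain ⟨v | w, rfl⟩ := e.surjective x
      · exact .inl ⟨v, rfl⟩
      · exact .inr ⟨w, rfl⟩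
    · exact Sum.inl_ne_inr (e.injective h)
    · have := e.map_adj_iff.1 h
      simp [S] at this
  refine ⟨_, S.overFin rfl, ?_, ?_, fun h => ?_⟩
  · obtain ⟨w, -, hw⟩ := h3
    exact ⟨w, hw⟩
  · exact le_antisymm (Nat.sInf_le h3)
      (le_csInf ⟨3, h3⟩ fun k hk => three_le_of_kRepresentable f hk)
  · have h' : (⊤ : SimpleGraph (Fin (c + 1))).Colorable c := h.of_hom (SimpleGraph.Embedding.toHom g)
    have := IsClique.card_le_of_colorable (s := Finset.univ) (fun _ _ _ _ h => h) h'
    simp at this
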